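/- arXiv:1009.4591 — 2 statements merged into one kernel-verified Lean document; each statement's English description precedes it below -/
import Mathlib

section
/- Weighted Hardy inequality with Gaussian weight: for λ > (2-N)/2, α ≥ 0, K(x) = |x|^{2λ} e^{α|x|²}, and every θ ∈ C_c^∞(ℝ^N), one has ∫ |∇θ|² K dx ≥ ∫ ( α²|x|² + α(N+2λ) + ((N-2+2λ)/2)² |x|^{-2} ) θ² K dx. -/
open MeasureTheory

lemma aux_locInt (N : ℕ) (hN : 1 ≤ N) (s : ℝ) (hs : -(N : ℝ) < s) :
    LocallyIntegrable (fun x : EuclideanSpace ℝ (Fin N) => ‖x‖ ^ s) := by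
  refine locallyIntegrable_of_norm_le_rpow (C := 1) (α := -s) (by simpa using hN)
    (by simp; linarith) (Filter.Eventually.of_forall fun x => ?_) ?_
  · rw [neg_neg, one_mul, Real.norm_of_nonneg (by positivity)]
  · exact (measurable_norm.pow_const s).aestronglyMeasurable

lemma aux_int (N : ℕ) (hN : 1 ≤ N) (s : ℝ) (hs : -(N : ℝ) < s)
    (u : EuclideanSpace ℝ (Fin N) → ℝ) (hu : Continuous u) (huc : HasCompactSupport u) :
    Integrable (fun x : EuclideanSpace ℝ (Fin N) => ‖x‖ ^ s * u x) := by
  have := (aux_locInt N hN s hs).integrable_smul_right_of_hasCompactSupport hu huc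
  simpa using this

lemma aux_euler (N : ℕ) (hN : 1 ≤ N) (s : ℝ) (hs : -(N : ℝ) < s)
    (h : EuclideanSpace ℝ (Fin N) → ℝ) (hh : ContDiff ℝ 1 h) (hc : HasCompactSupport h) :
    ∫ x, ‖x‖ ^ s * (fderiv ℝ h x x) = -((N : ℝ) + s) * ∫ x, ‖x‖ ^ s * h x := by
  have hfd : Continuous (fderiv ℝ h) := hh.continuous_fderiv (by norm_num)
  have hfc : HasCompactSupport (fderiv ℝ h) := hc.fderiv ℝ
  obtain ⟨C, hC⟩ := hfd.bounded_above_of_compact_support hfc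
  obtain ⟨R, hR0, hR⟩ := hfc.isCompact.isBounded.exists_pos_norm_le
  have hC0 : 0 ≤ C := (norm_nonneg _).trans (hC 0)
  have hm : Measurable (fun x : EuclideanSpace ℝ (Fin N) => ‖x‖ ^ s) := measurable_norm.pow_const s
  have key := hasDerivAt_integral_of_dominated_loc_of_deriv_le (μ := volume)
    (F := fun (t : ℝ) (x : EuclideanSpace ℝ (Fin N)) => ‖x‖ ^ s * h (t • x))
    (F' := fun (t : ℝ) (x : EuclideanSpace ℝ (Fin N)) => ‖x‖ ^ s * (fderiv ℝ h (t • x) x))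
    (x₀ := (1 : ℝ)) (s := Metric.ball 1 (1/2))
    (bound := (Metric.closedBall 0 (2*R)).indicator (fun x => ‖x‖ ^ s * (C * (2 * R))))
    (Metric.ball_mem_nhds _ (by norm_num)) ?_ ?_ ?_ ?_ ?_ ?_
  · have h2 := key.2
    have hA : (fun t : ℝ => ∫ x, ‖x‖ ^ s * h (t • x)) =ᶠ[nhds 1]
        fun t => t ^ (-((N:ℝ) + s)) * ∫ x, ‖x‖ ^ s * h x := by
      filter_upwards [lt_mem_nhds (zero_lt_one' ℝ)] with t ht
      have := Measure.integral_comp_smul (volume : Measure (EuclideanSpace ℝ (Fin N)))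
        (fun x => ‖x‖ ^ s * h x) t
      have e : ∀ x : EuclideanSpace ℝ (Fin N), ‖t • x‖ ^ s * h (t • x)
          = t ^ s * (‖x‖ ^ s * h (t • x)) := by
        intro x
        rw [norm_smul, Real.norm_of_nonneg ht.le, Real.mul_rpow ht.le (norm_nonneg _), mul_assoc]
      simp only [e, integral_const_mul, smul_eq_mul, finrank_euclideanSpace, Fintype.card_fin] at this
      rw [abs_of_pos (by positivity)] at this
      have hts : t ^ s ≠ 0 := (Real.rpow_pos_of_pos ht s).ne'
      rw [Real.rpow_neg ht.le, Real.rpow_add ht, Real.rpow_natCast]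
      have htn : t ^ N ≠ 0 := by positivity
      field_simp
      field_simp at this
      linarith
    have hB : HasDerivAt (fun t : ℝ => t ^ (-((N:ℝ) + s)) * ∫ x, ‖x‖ ^ s * h x)
        (-((N : ℝ) + s) * ∫ x, ‖x‖ ^ s * h x) 1 := by
      have := (Real.hasDerivAt_rpow_const (x := 1) (p := -((N:ℝ) + s)) (Or.inl one_ne_zero)).mul_const
        (∫ x, ‖x‖ ^ s * h x)
      simpa using this
    have := (h2.congr_of_eventuallyEq hA.symm).unique hB
    simpa using this
  · refine Filter.Eventually.of_forall fun t => ?_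
    exact (hm.aestronglyMeasurable).mul
      (hh.continuous.comp (continuous_const_smul t)).aestronglyMeasurable
  · simpa using aux_int N hN s hs h hh.continuous hc
  · refine hm.aestronglyMeasurable.mul (Continuous.aestronglyMeasurable ?_)
    simp only [one_smul]
    exact hfd.clm_apply continuous_id
  · refine Filter.Eventually.of_forall fun x t ht => ?_
    have ht1 : 1/2 < t := by
      rw [Metric.mem_ball, Real.dist_eq, abs_lt] at ht; linarith
    by_cases hx : x ∈ Metric.closedBall (0 : EuclideanSpace ℝ (Fin N)) (2 * R)
    · rw [Set.indicator_of_mem hx, norm_mul, Real.norm_of_nonneg (by positivity : 0 ≤ ‖x‖ ^ s)]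
      have hx' : ‖x‖ ≤ 2 * R := by simpa using hx
      gcongr
      exact (ContinuousLinearMap.le_opNorm _ _).trans (mul_le_mul (hC _) hx' (norm_nonneg _) hC0)
    · have hx' : 2 * R < ‖x‖ := by simpa using hx
      have : fderiv ℝ h (t • x) = 0 := by
        apply image_eq_zero_of_notMem_tsupport
        intro hmem
        have := hR _ hmem
        rw [norm_smul, Real.norm_of_nonneg (by linarith)] at this
        nlinarith
      rw [Set.indicator_of_notMem hx, this]
      simp
  · rw [integrable_indicator_iff Metric.isClosed_closedBall.measurableSet]
    exact ((aux_locInt N hN s hs).integrableOn_isCompact (isCompact_closedBall _ _)).mul_const _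
  · refine Filter.Eventually.of_forall fun x t ht => ?_
    have h1 : HasDerivAt (fun t : ℝ => t • x) x t := by
      simpa using (hasDerivAt_id t).smul_const x
    have h2 := ((hh.differentiable (by norm_num)) (t • x)).hasFDerivAt.comp_hasDerivAt t h1
    exact h2.const_mul _

/-- Weighted Hardy inequality with Gaussian weight `K(x) = |x|^{2λ} e^{α|x|²}`. -/
theorem stmt5 (N : ℕ) (hN : 3 ≤ N) (l α : ℝ) (hl : (2 - (N : ℝ)) / 2 < l) (hα : 0 ≤ α)
    (K : EuclideanSpace ℝ (Fin N) → ℝ)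
    (hK : ∀ x, K x = ‖x‖ ^ (2 * l) * Real.exp (α * ‖x‖ ^ 2))
    (θ : EuclideanSpace ℝ (Fin N) → ℝ) (hθ : ContDiff ℝ (⊤ : ℕ∞) θ) (hθc : HasCompactSupport θ) :
    ∫ x, (α ^ 2 * ‖x‖ ^ 2 + α * ((N : ℝ) + 2 * l) + (((N : ℝ) - 2 + 2 * l) / 2) ^ 2 / ‖x‖ ^ 2)
        * (θ x) ^ 2 * K x
      ≤ ∫ x, ‖gradient θ x‖ ^ 2 * K x := by
  have hN1 : 1 ≤ N := by omega
  have hs1 : -(N : ℝ) < 2 * l := by linarith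
  have hs2 : -(N : ℝ) < 2 * l - 2 := by linarith
  have : Nonempty (Fin N) := ⟨⟨0, by omega⟩⟩
  have hθ1 : ContDiff ℝ 1 θ := hθ.of_le (by exact_mod_cast le_top)
  have hfd : Continuous (fderiv ℝ θ) := hθ1.continuous_fderiv (by norm_num)
  have hEd : ContDiff ℝ 1 (fun x : EuclideanSpace ℝ (Fin N) => Real.exp (α * ‖x‖ ^ 2)) :=
    (contDiff_const.mul (contDiff_norm_sq ℝ)).exp
  set h : EuclideanSpace ℝ (Fin N) → ℝ := fun x => θ x ^ 2 * Real.exp (α * ‖x‖ ^ 2) with hh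
  have hhd : ContDiff ℝ 1 h := (hθ1.pow 2).mul hEd
  have hhc : HasCompactSupport h := by
    have : h = fun x => θ x * (θ x * Real.exp (α * ‖x‖ ^ 2)) := by funext x; simp only [hh]; ring
    rw [this]; exact hθc.mul_right
  have hDc : Continuous (fun x => fderiv ℝ h x x) :=
    (hhd.continuous_fderiv (by norm_num)).clm_apply continuous_id
  have hDcc : HasCompactSupport (fun x => fderiv ℝ h x x) :=
    (hhc.fderiv ℝ).mono (fun x hx hx0 => hx (by simp [hx0]))
  have hD : ∀ x, fderiv ℝ h x x = (2 * θ x * fderiv ℝ θ x x + 2 * α * ‖x‖ ^ 2 * θ x ^ 2)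
      * Real.exp (α * ‖x‖ ^ 2) := by
    intro x
    have a1 := ((hθ1.differentiable (by norm_num)) x).hasFDerivAt.pow 2
    have a2 := ((hasStrictFDerivAt_norm_sq x).hasFDerivAt.const_mul α).exp
    have a3 := (a1.mul a2).fderiv
    have : fderiv ℝ h x = _ := a3
    rw [this]
    simp
    ring
  have i1 := aux_int N hN1 _ hs1 h hhd.continuous hhc
  have i2 := aux_int N hN1 _ hs2 h hhd.continuous hhc
  have i3 := aux_int N hN1 _ hs1 _ hDc hDcc
  have i4 := aux_int N hN1 _ hs2 _ hDc hDcc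
  have i5 : Integrable (fun x : EuclideanSpace ℝ (Fin N) => ‖x‖ ^ (2 * l) * (‖x‖ ^ 2 * h x)) :=
    aux_int N hN1 _ hs1 _ ((continuous_norm.pow 2).mul hhd.continuous) hhc.mul_left
  have i6 : Integrable (fun x : EuclideanSpace ℝ (Fin N) =>
      ‖x‖ ^ (2 * l) * (‖fderiv ℝ θ x‖ ^ 2 * Real.exp (α * ‖x‖ ^ 2))) := by
    refine aux_int N hN1 _ hs1 _ ((hfd.norm.pow 2).mul hEd.continuous) ?_
    exact (hθc.fderiv ℝ).mono (fun x hx hx0 => hx (by simp [hx0]))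
  have e1 := aux_euler N hN1 _ hs1 h hhd hhc
  have e2 := aux_euler N hN1 _ hs2 h hhd hhc
  have hgn : ∀ x, ‖gradient θ x‖ = ‖fderiv ℝ θ x‖ := fun x => by simp [gradient]
  set c : ℝ := ((N : ℝ) - 2 + 2 * l) / 2 with hcdef
  have hne : ∀ᵐ x : EuclideanSpace ℝ (Fin N), x ≠ 0 := by
    have : Nontrivial (EuclideanSpace ℝ (Fin N)) := inferInstance
    exact Measure.ae_ne volume 0
  have hr : ∀ x : EuclideanSpace ℝ (Fin N), x ≠ 0 → ‖x‖ ^ (2 * l) = ‖x‖ ^ (2 * l - 2) * ‖x‖ ^ 2 := by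
    intro x hx
    rw [← Real.rpow_natCast, ← Real.rpow_add (norm_pos_iff.2 hx)]
    norm_num
  have L : ∫ x, (α ^ 2 * ‖x‖ ^ 2 + α * ((N : ℝ) + 2 * l) + c ^ 2 / ‖x‖ ^ 2) * (θ x) ^ 2 * K x
      = ∫ x, (α ^ 2 * (‖x‖ ^ (2 * l) * (‖x‖ ^ 2 * h x)) + α * ((N : ℝ) + 2 * l) * (‖x‖ ^ (2 * l) * h x)
        + c ^ 2 * (‖x‖ ^ (2 * l - 2) * h x)) := by
    refine integral_congr_ae ?_
    filter_upwards [hne] with x hx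
    have : ‖x‖ ≠ 0 := norm_ne_zero_iff.2 hx
    simp only [hK, hh, hr x hx]
    field_simp
  have Rr : ∫ x, ‖gradient θ x‖ ^ 2 * K x
      = ∫ x, ‖x‖ ^ (2 * l) * (‖fderiv ℝ θ x‖ ^ 2 * Real.exp (α * ‖x‖ ^ 2)) := by
    congr 1; funext x; rw [hgn, hK]; ring
  rw [L, Rr]
  have iJ1 : Integrable (fun x : EuclideanSpace ℝ (Fin N) =>
      α * (‖x‖ ^ (2 * l) * fderiv ℝ h x x) + α * ((N : ℝ) + 2 * l) * (‖x‖ ^ (2 * l) * h x)) :=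
    (i3.const_mul _).add (i1.const_mul _)
  have iJ2 : Integrable (fun x : EuclideanSpace ℝ (Fin N) =>
      c * (‖x‖ ^ (2 * l - 2) * fderiv ℝ h x x)
        + c * ((N : ℝ) + (2 * l - 2)) * (‖x‖ ^ (2 * l - 2) * h x)) :=
    (i4.const_mul _).add (i2.const_mul _)
  have z1 : ∫ x, (α * (‖x‖ ^ (2 * l) * fderiv ℝ h x x)
      + α * ((N : ℝ) + 2 * l) * (‖x‖ ^ (2 * l) * h x)) = 0 := by
    rw [integral_add (i3.const_mul _) (i1.const_mul _), integral_const_mul, integral_const_mul, e1]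
    ring
  have z2 : ∫ x, (c * (‖x‖ ^ (2 * l - 2) * fderiv ℝ h x x)
        + c * ((N : ℝ) + (2 * l - 2)) * (‖x‖ ^ (2 * l - 2) * h x)) = 0 := by
    rw [integral_add (i4.const_mul _) (i2.const_mul _), integral_const_mul, integral_const_mul, e2]
    ring
  have z : ∫ x, ‖x‖ ^ (2 * l) * (‖fderiv ℝ θ x‖ ^ 2 * Real.exp (α * ‖x‖ ^ 2))
      = ∫ x, (‖x‖ ^ (2 * l) * (‖fderiv ℝ θ x‖ ^ 2 * Real.exp (α * ‖x‖ ^ 2))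
        + ((α * (‖x‖ ^ (2 * l) * fderiv ℝ h x x) + α * ((N : ℝ) + 2 * l) * (‖x‖ ^ (2 * l) * h x))
        + (c * (‖x‖ ^ (2 * l - 2) * fderiv ℝ h x x)
          + c * ((N : ℝ) + (2 * l - 2)) * (‖x‖ ^ (2 * l - 2) * h x)))) := by
    refine Eq.symm ((integral_add i6 (iJ1.add iJ2)).trans ?_)
    have := integral_add iJ1 iJ2
    rw [z1, z2, add_zero] at this
    refine Eq.trans (congrArg _ this) (add_zero _)
  rw [z]
  refine integral_mono_ae (((i5.const_mul _).add (i1.const_mul _)).add (i2.const_mul _))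
    (i6.add (iJ1.add iJ2)) ?_
  filter_upwards [hne] with x hx
  have hd : (fderiv ℝ θ x x) ^ 2 ≤ ‖fderiv ℝ θ x‖ ^ 2 * ‖x‖ ^ 2 := by
    have := (fderiv ℝ θ x).le_opNorm x
    rw [← mul_pow, ← sq_abs]
    exact pow_le_pow_left₀ (abs_nonneg _) this 2
  have hA : 0 ≤ ‖x‖ ^ (2 * l - 2) := by positivity
  have hE : 0 ≤ Real.exp (α * ‖x‖ ^ 2) := (Real.exp_pos _).le
  have hNc : (N : ℝ) + (2 * l - 2) = 2 * c := by rw [hcdef]; ring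
  rw [hNc]
  simp only [hD, hr x hx]
  simp only [hh]
  generalize ‖x‖ ^ (2 * l - 2) = A at *
  generalize Real.exp (α * ‖x‖ ^ 2) = E at *
  generalize fderiv ℝ θ x x = d at *
  generalize ‖fderiv ℝ θ x‖ = g at *
  generalize ‖x‖ ^ 2 = q at *
  generalize θ x = t at *
  have hp : 0 ≤ A * E * ((g ^ 2 * q - d ^ 2) + (d + t * (α * q + c)) ^ 2) :=
    mul_nonneg (mul_nonneg hA hE) (add_nonneg (by linarith) (sq_nonneg _))
  linarith
end

section
/- Coercivity estimate for the weighted norm: for the weight K(x) = |x|^{2λ} e^{α|x|²} with λ > -(N-2)/2, α > 0, β > -2, and p > 1, for any ε > 0 there exists C_ε > 0 such that for all θ in X := H¹(ℝ^N, K dx) ∩ L^{p+1}(ℝ^N, |x|^β K dx), one has ∫θ²K dx ≤ ε(∫|∇θ|²K dx + (∫|θ|^{p+1}|x|^β K dx)) + C_ε. -/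
open MeasureTheory

lemma aux_fderiv_le {N : ℕ} (θ : EuclideanSpace ℝ (Fin N) → ℝ) (x v : EuclideanSpace ℝ (Fin N)) :
    |fderiv ℝ θ x v| ≤ ‖gradient θ x‖ * ‖v‖ := by
  have h1 : ‖fderiv ℝ θ x‖ = ‖gradient θ x‖ := by
    rw [← toDual_gradient]; exact LinearIsometryEquiv.norm_map _ _
  rw [← h1]
  exact (fderiv ℝ θ x).le_opNorm v

lemma aux_coord {N : ℕ} (K θ : EuclideanSpace ℝ (Fin N) → ℝ) (hθ : Differentiable ℝ θ)
    (hI1 : Integrable (fun x => ‖gradient θ x‖ ^ 2 * K x))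
    (hI2 : Integrable (fun x => (θ x) ^ 2 * K x))
    (hK0 : ∀ x, 0 ≤ K x)
    (g g' : ℝ → ℝ) (hgm : Measurable g) (hgm' : Measurable g')
    (hg : ∀ s, 0 ≤ s → HasDerivAt g (g' s) s) (M : ℝ)
    (hb1 : ∀ x, |g (‖x‖ ^ 2)| * (1 + ‖x‖) ≤ M * K x)
    (hb2 : ∀ x : EuclideanSpace ℝ (Fin N), |‖x‖ ^ 2 * g' (‖x‖ ^ 2)| ≤ M * K x) (i : Fin N) :
    Integrable (fun x => (θ x) ^ 2 * (g (‖x‖ ^ 2) + 2 * (x i) ^ 2 * g' (‖x‖ ^ 2))) ∧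
    Integrable (fun x => 2 * θ x * fderiv ℝ θ x (EuclideanSpace.single i 1) * (g (‖x‖ ^ 2) * x i)) ∧
    ∫ x, (θ x) ^ 2 * (g (‖x‖ ^ 2) + 2 * (x i) ^ 2 * g' (‖x‖ ^ 2)) =
    - ∫ x, 2 * θ x * fderiv ℝ θ x (EuclideanSpace.single i 1) * (g (‖x‖ ^ 2) * x i) := by
  have hθc := hθ.continuous
  have hθm : Measurable θ := hθc.measurable
  have hdm : Measurable (fun x => fderiv ℝ θ x (EuclideanSpace.single i 1)) :=
    measurable_fderiv_apply_const ℝ θ _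
  have hxi : ∀ x : EuclideanSpace ℝ (Fin N), |x i| ≤ ‖x‖ := fun x => by
    simpa using PiLp.norm_apply_le x i
  have hxm : Measurable (fun x : EuclideanSpace ℝ (Fin N) => x i) := by fun_prop
  have hxi2 : ∀ x : EuclideanSpace ℝ (Fin N), (x i)^2 ≤ ‖x‖^2 := fun x => by
    rw [← sq_abs]; exact pow_le_pow_left₀ (abs_nonneg _) (hxi x) 2
  have hb0 : ∀ x, |g (‖x‖ ^ 2)| ≤ M * K x := fun x => by
    refine le_trans ?_ (hb1 x)
    nlinarith [mul_nonneg (abs_nonneg (g (‖x‖ ^ 2))) (norm_nonneg x)]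
  have hb3 : ∀ x, |g (‖x‖ ^ 2) * x i| ≤ M * K x := fun x => by
    refine le_trans ?_ (hb1 x)
    rw [abs_mul]
    nlinarith [mul_le_mul_of_nonneg_left (hxi x) (abs_nonneg (g (‖x‖ ^ 2))), abs_nonneg (g (‖x‖ ^ 2))]
  have J1 : Integrable (fun x => (θ x) ^ 2 * (g (‖x‖ ^ 2) + 2 * (x i) ^ 2 * g' (‖x‖ ^ 2))) := by
    refine Integrable.mono' (hI2.const_mul (3 * M)) (by fun_prop) (Filter.Eventually.of_forall fun x => ?_)
    rw [Real.norm_eq_abs, abs_mul, abs_of_nonneg (sq_nonneg (θ x))]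
    have : |g (‖x‖ ^ 2) + 2 * (x i) ^ 2 * g' (‖x‖ ^ 2)| ≤ 3 * M * K x := by
      refine (abs_add_le _ _).trans ?_
      have h2 : |2 * (x i) ^ 2 * g' (‖x‖ ^ 2)| ≤ 2 * |‖x‖ ^ 2 * g' (‖x‖ ^ 2)| := by
        rw [abs_mul, abs_mul (‖x‖^2), abs_of_nonneg (by positivity : 0 ≤ 2 * (x i)^2), abs_of_nonneg (by positivity : 0 ≤ ‖x‖^2)]
        nlinarith [mul_le_mul_of_nonneg_right (hxi2 x) (abs_nonneg (g' (‖x‖ ^ 2)))]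
      linarith [hb0 x, hb2 x]
    calc _ ≤ θ x ^ 2 * (3 * M * K x) := mul_le_mul_of_nonneg_left this (sq_nonneg _)
      _ = _ := by ring
  have J2 : Integrable (fun x => 2 * θ x * fderiv ℝ θ x (EuclideanSpace.single i 1) * (g (‖x‖ ^ 2) * x i)) := by
    refine Integrable.mono' ((hI2.add hI1).const_mul M) (by fun_prop) (Filter.Eventually.of_forall fun x => ?_)
    rw [Real.norm_eq_abs, abs_mul]
    have h1 : |2 * θ x * fderiv ℝ θ x (EuclideanSpace.single i 1)| ≤ θ x ^ 2 + ‖gradient θ x‖ ^ 2 := by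
      have := aux_fderiv_le θ x (EuclideanSpace.single i 1)
      simp only [PiLp.norm_single, norm_one, mul_one] at this
      have h3 := pow_le_pow_left₀ (abs_nonneg _) this 2
      rw [sq_abs] at h3
      rw [abs_le]
      constructor <;> nlinarith [sq_nonneg (θ x + fderiv ℝ θ x (EuclideanSpace.single i 1)), sq_nonneg (θ x - fderiv ℝ θ x (EuclideanSpace.single i 1))]
    calc _ ≤ (θ x ^ 2 + ‖gradient θ x‖ ^ 2) * (M * K x) :=
          mul_le_mul h1 (hb3 x) (abs_nonneg _) (by positivity)
      _ = _ := by simp only [Pi.add_apply]; ring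
  have J3 : Integrable (fun x => (θ x) ^ 2 * (g (‖x‖ ^ 2) * x i)) := by
    refine Integrable.mono' (hI2.const_mul M) (by fun_prop) (Filter.Eventually.of_forall fun x => ?_)
    rw [Real.norm_eq_abs, abs_mul, abs_of_nonneg (sq_nonneg (θ x))]
    calc _ ≤ θ x ^ 2 * (M * K x) := mul_le_mul_of_nonneg_left (hb3 x) (sq_nonneg _)
      _ = _ := by ring
  refine ⟨J1, J2, ?_⟩
  refine integral_bilinear_hasLineDerivAt_right_eq_neg_left_of_integrable
    (B := ContinuousLinearMap.mul ℝ ℝ) (v := EuclideanSpace.single i 1)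
    (f := fun x => θ x ^ 2) (g := fun x => g (‖x‖ ^ 2) * x i)
    (f' := fun x => 2 * θ x * fderiv ℝ θ x (EuclideanSpace.single i 1))
    (g' := fun x => g (‖x‖ ^ 2) + 2 * (x i) ^ 2 * g' (‖x‖ ^ 2)) J2 J1 J3 ?_ ?_
  · intro x _
    have h := ((hθ x).hasFDerivAt.pow 2).hasLineDerivAt (EuclideanSpace.single i 1)
    convert h using 1
    simp [mul_assoc]
  · intro x _
    have h1 : HasFDerivAt (fun x : EuclideanSpace ℝ (Fin N) => ‖x‖ ^ 2) (2 • (innerSL ℝ x)) x :=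
      (hasStrictFDerivAt_norm_sq x).hasFDerivAt
    have h2 := (hg (‖x‖ ^ 2) (by positivity)).comp_hasFDerivAt x h1
    have h3 : HasFDerivAt (fun x : EuclideanSpace ℝ (Fin N) => x i) (EuclideanSpace.proj i : EuclideanSpace ℝ (Fin N) →L[ℝ] ℝ) x :=
      (EuclideanSpace.proj i : EuclideanSpace ℝ (Fin N) →L[ℝ] ℝ).hasFDerivAt
    have h := (h2.mul h3).hasLineDerivAt (EuclideanSpace.single i 1)
    have e : g (‖x‖ ^ 2) + 2 * (x i) ^ 2 * g' (‖x‖ ^ 2) = (((g ∘ fun x => ‖x‖ ^ 2) x • (EuclideanSpace.proj i : EuclideanSpace ℝ (Fin N) →L[ℝ] ℝ) + x.ofLp i • g' (‖x‖ ^ 2) • 2 • (innerSL ℝ) x)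
      (EuclideanSpace.single i 1)) := by
      simp [EuclideanSpace.inner_single_right]
      ring
    rw [e]
    exact h

lemma aux_div {N : ℕ} (K θ : EuclideanSpace ℝ (Fin N) → ℝ) (hθ : Differentiable ℝ θ)
    (hI1 : Integrable (fun x => ‖gradient θ x‖ ^ 2 * K x))
    (hI2 : Integrable (fun x => (θ x) ^ 2 * K x))
    (hK0 : ∀ x, 0 ≤ K x)
    (g g' : ℝ → ℝ) (hgm : Measurable g) (hgm' : Measurable g')
    (hg : ∀ s, 0 ≤ s → HasDerivAt g (g' s) s) (M : ℝ)
    (hb1 : ∀ x, |g (‖x‖ ^ 2)| * (1 + ‖x‖) ≤ M * K x)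
    (hb2 : ∀ x : EuclideanSpace ℝ (Fin N), |‖x‖ ^ 2 * g' (‖x‖ ^ 2)| ≤ M * K x) :
    Integrable (fun x => (θ x) ^ 2 * (N * g (‖x‖ ^ 2) + 2 * (‖x‖ ^ 2 * g' (‖x‖ ^ 2))) +
      2 * θ x * fderiv ℝ θ x x * g (‖x‖ ^ 2)) ∧
    ∫ x, ((θ x) ^ 2 * (N * g (‖x‖ ^ 2) + 2 * (‖x‖ ^ 2 * g' (‖x‖ ^ 2))) +
      2 * θ x * fderiv ℝ θ x x * g (‖x‖ ^ 2)) = 0 := by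
  have H := aux_coord K θ hθ hI1 hI2 hK0 g g' hgm hgm' hg M hb1 hb2
  have e : (fun x => (θ x) ^ 2 * (N * g (‖x‖ ^ 2) + 2 * (‖x‖ ^ 2 * g' (‖x‖ ^ 2))) +
      2 * θ x * fderiv ℝ θ x x * g (‖x‖ ^ 2)) = fun x => ∑ i : Fin N,
      ((θ x) ^ 2 * (g (‖x‖ ^ 2) + 2 * (x i) ^ 2 * g' (‖x‖ ^ 2)) +
       2 * θ x * fderiv ℝ θ x (EuclideanSpace.single i 1) * (g (‖x‖ ^ 2) * x i)) := by
    funext x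
    have h1 : ‖x‖ ^ 2 = ∑ i, (x i) ^ 2 := by
      rw [EuclideanSpace.norm_sq_eq]; simp
    have h2 : fderiv ℝ θ x x = ∑ i, fderiv ℝ θ x (EuclideanSpace.single i 1) * x i := by
      have : x = ∑ i, x i • EuclideanSpace.single i (1:ℝ) := by
        ext j; simp [Finset.sum_apply, Pi.single_apply]
      have h := congrArg (fderiv ℝ θ x) this
      rw [map_sum] at h
      rw [h]
      simp [mul_comm]
    rw [Finset.sum_add_distrib, ← Finset.mul_sum, Finset.sum_add_distrib]
    rw [h2]
    generalize hG : g (‖x‖ ^ 2) = G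
    generalize hG' : g' (‖x‖ ^ 2) = G'
    rw [h1]
    simp only [Finset.sum_const, Finset.card_univ, Fintype.card_fin, nsmul_eq_mul, Finset.mul_sum, Finset.sum_mul]
    congr 1
    · congr 2; exact Finset.sum_congr rfl fun i _ => by ring
    · exact Finset.sum_congr rfl fun i _ => by ring
  rw [e]
  refine ⟨integrable_finsetSum _ fun i _ => (H i).1.add (H i).2.1, ?_⟩
  have hh := integral_finsetSum (Finset.univ : Finset (Fin N)) fun i _ => (H i).1.add (H i).2.1
  simp only [Pi.add_apply] at hh
  rw [hh]
  refine Finset.sum_eq_zero fun i _ => ?_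
  rw [integral_add (H i).1 (H i).2.1, (H i).2.2]; simp

/-- auxiliary radial profile -/
noncomputable def auxG (l α m σ δ s : ℝ) : ℝ :=
  s ^ (l + m) * (s + σ) ^ (-m) * Real.exp (α * s) * (s + δ)⁻¹

/-- its derivative -/
noncomputable def auxG' (l α m σ δ s : ℝ) : ℝ :=
  (((l + m) * s ^ (l + m - 1) * (s + σ) ^ (-m) + s ^ (l + m) * ((-m) * (s + σ) ^ (-m - 1))) *
    Real.exp (α * s) + s ^ (l + m) * (s + σ) ^ (-m) * (Real.exp (α * s) * α)) * (s + δ)⁻¹ +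
  s ^ (l + m) * (s + σ) ^ (-m) * Real.exp (α * s) * (-1 / (s + δ) ^ 2)

lemma auxG_deriv (l α m σ δ s : ℝ) (hs : 0 ≤ s) (hσ : 0 < σ) (hδ : 0 < δ) (hm : 1 ≤ l + m) :
    HasDerivAt (auxG l α m σ δ) (auxG' l α m σ δ s) s := by
  have h1 : HasDerivAt (fun s : ℝ => s ^ (l + m)) ((l + m) * s ^ (l + m - 1)) s :=
    Real.hasDerivAt_rpow_const (Or.inr hm)
  have h2 : HasDerivAt (fun s : ℝ => (s + σ) ^ (-m)) ((-m) * (s + σ) ^ (-m - 1)) s := by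
    have := ((hasDerivAt_id s).add_const σ).rpow_const (p := -m) (Or.inl (by simp; positivity))
    simpa using this
  have h3 : HasDerivAt (fun s : ℝ => Real.exp (α * s)) (Real.exp (α * s) * α) s := by
    simpa using ((hasDerivAt_id s).const_mul α).exp
  have h4 : HasDerivAt (fun s : ℝ => (s + δ)⁻¹) (-1 / (s + δ) ^ 2) s :=
    ((hasDerivAt_id s).add_const δ).fun_inv (by simp; positivity)
  exact ((h1.mul h2).mul h3).mul h4

lemma auxG_mul (l α m σ δ s : ℝ) (hs : 0 ≤ s) (hσ : 0 < σ) (hδ : 0 < δ) (hm : 1 ≤ l + m) :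
    s * auxG' l α m σ δ s =
      auxG l α m σ δ s * (l + m * (σ / (s + σ)) + α * s - s / (s + δ)) := by
  have h1 : s * s ^ (l + m - 1) = s ^ (l + m) := by
    rcases hs.eq_or_lt with h | h
    · rw [← h, Real.zero_rpow (by linarith : l + m ≠ 0)]; simp
    · rw [Real.rpow_sub_one h.ne']; field_simp
  have h2 : (s + σ) ^ (-m - 1) = (s + σ) ^ (-m) / (s + σ) := Real.rpow_sub_one (by positivity) _
  unfold auxG auxG'
  rw [h2, ← h1]
  have : s + σ ≠ 0 := by positivity
  have : s + δ ≠ 0 := by positivity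
  generalize s ^ (l + m - 1) = A
  generalize (s + σ) ^ (-m) = B
  generalize Real.exp (α * s) = D
  field_simp
  ring

lemma auxG_eq (l α m σ δ t : ℝ) (ht : 0 ≤ t) (hm0 : 0 < m) (hm : 1 ≤ l + m) :
    auxG l α m σ δ (t ^ 2) = (t ^ (2 * l) * Real.exp (α * t ^ 2)) *
      ((t ^ 2) ^ m * (t ^ 2 + σ) ^ (-m)) / (t ^ 2 + δ) := by
  unfold auxG
  rcases ht.eq_or_lt with h | h
  · subst h
    simp [Real.zero_rpow (by linarith : l + m ≠ 0), Real.zero_rpow hm0.ne']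
  · rw [Real.rpow_add (by positivity), Real.rpow_mul ht]
    simp only [Real.rpow_two]
    ring

lemma aux_chi (m σ s : ℝ) (hs : 0 ≤ s) (hσ : 0 < σ) (hm : 0 < m) :
    s ^ m * (s + σ) ^ (-m) = (s / (s + σ)) ^ m := by
  rw [Real.div_rpow hs (by positivity), Real.rpow_neg (by positivity)]; rfl

lemma aux_hardy1 (N : ℕ) (l α σ δ M : ℝ) (hα : 0 < α) (hσ : 0 < σ) (hδ : 0 < δ)
    (hc : 0 < (N : ℝ) - 2 + 2 * l)
    (hM : ∀ s : ℝ, 0 ≤ s → s ≤ M * ((s + δ) * ((N : ℝ) - 2 + 2 * l + 2 * α * s)))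
    (m : ℝ) (hm0 : 0 < m) (hm : 1 ≤ l + m)
    (K : EuclideanSpace ℝ (Fin N) → ℝ)
    (hK : ∀ x, K x = ‖x‖ ^ (2 * l) * Real.exp (α * ‖x‖ ^ 2))
    (θ : EuclideanSpace ℝ (Fin N) → ℝ) (hθ : Differentiable ℝ θ)
    (hI1 : Integrable (fun x => ‖gradient θ x‖ ^ 2 * K x))
    (hI2 : Integrable (fun x => (θ x) ^ 2 * K x)) :
    ∫ x, θ x ^ 2 * K x * ((‖x‖ ^ 2 / (‖x‖ ^ 2 + σ)) ^ m *
      (((N : ℝ) - 2 + 2 * l + 2 * α * ‖x‖ ^ 2) / (‖x‖ ^ 2 + δ))) ≤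
      4 * M * ∫ x, ‖gradient θ x‖ ^ 2 * K x := by
  set c := (N : ℝ) - 2 + 2 * l with hcdef
  have hK0 : ∀ x, 0 ≤ K x := fun x => by rw [hK]; positivity
  have hM0 : 0 ≤ M := by
    have := hM 1 (by norm_num)
    by_contra h
    push Not at h
    have h2 : 0 < (1 + δ) * (c + 2 * α * 1) := by positivity
    nlinarith
  have hchi1 : ∀ s : ℝ, 0 ≤ s → (s / (s + σ)) ^ m ≤ 1 := fun s hs =>
    Real.rpow_le_one (by positivity) (by rw [div_le_one (by positivity)]; linarith) hm0.le
  have hchi0 : ∀ s : ℝ, 0 ≤ s → 0 ≤ (s / (s + σ)) ^ m := fun s hs => by positivity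
  have hG : ∀ x : EuclideanSpace ℝ (Fin N), auxG l α m σ δ (‖x‖ ^ 2) =
      K x * (‖x‖ ^ 2 / (‖x‖ ^ 2 + σ)) ^ m / (‖x‖ ^ 2 + δ) := fun x => by
    rw [auxG_eq l α m σ δ _ (norm_nonneg x) hm0 hm, hK, aux_chi m σ _ (by positivity) hσ hm0]
  have hG0 : ∀ x : EuclideanSpace ℝ (Fin N), 0 ≤ auxG l α m σ δ (‖x‖ ^ 2) := fun x => by
    rw [hG]
    have := hK0 x
    positivity
  have hGle : ∀ x : EuclideanSpace ℝ (Fin N), auxG l α m σ δ (‖x‖ ^ 2) * (‖x‖ ^ 2 + δ) ≤ K x :=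
      fun x => by
    rw [hG, div_mul_cancel₀ _ (by positivity)]
    exact mul_le_of_le_one_right (hK0 x) (hchi1 _ (by positivity))
  set A := 1 + 2 / δ + (|l| + m + 1) / δ + α with hA
  have hA0 : 0 ≤ A := by positivity
  have hb1 : ∀ x : EuclideanSpace ℝ (Fin N), |auxG l α m σ δ (‖x‖ ^ 2)| * (1 + ‖x‖) ≤ A * K x := by
    intro x
    rw [abs_of_nonneg (hG0 x)]
    have h1 : 1 + ‖x‖ ≤ A * (‖x‖ ^ 2 + δ) := by
      have h3 : 1 + ‖x‖ ≤ (1 + 2 / δ) * (‖x‖ ^ 2 + δ) := by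
        have : (1 + 2 / δ) * (‖x‖ ^ 2 + δ) = ‖x‖ ^ 2 + δ + 2 + 2 / δ * ‖x‖ ^ 2 := by
          field_simp; ring
        rw [this]
        have : 0 ≤ 2 / δ * ‖x‖ ^ 2 := by positivity
        nlinarith [sq_nonneg (‖x‖ - 1)]
      refine h3.trans (mul_le_mul_of_nonneg_right ?_ (by positivity))
      have : 0 ≤ (|l| + m + 1) / δ := by positivity
      rw [hA]; linarith
    calc _ ≤ auxG l α m σ δ (‖x‖ ^ 2) * (A * (‖x‖ ^ 2 + δ)) := mul_le_mul_of_nonneg_left h1 (hG0 x)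
      _ = A * (auxG l α m σ δ (‖x‖ ^ 2) * (‖x‖ ^ 2 + δ)) := by ring
      _ ≤ _ := mul_le_mul_of_nonneg_left (hGle x) hA0
  have hb2 : ∀ x : EuclideanSpace ℝ (Fin N),
      |‖x‖ ^ 2 * auxG' l α m σ δ (‖x‖ ^ 2)| ≤ A * K x := by
    intro x
    rw [auxG_mul l α m σ δ _ (by positivity) hσ hδ hm, abs_mul, abs_of_nonneg (hG0 x)]
    generalize hs : ‖x‖ ^ 2 = s at *
    have hs0 : 0 ≤ s := by rw [← hs]; positivity
    have h1 : |l + m * (σ / (s + σ)) + α * s - s / (s + δ)| ≤ A * (s + δ) := by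
      have e1 : 0 ≤ σ / (s + σ) := by positivity
      have e2 : σ / (s + σ) ≤ 1 := by rw [div_le_one (by positivity)]; linarith
      have e3 : 0 ≤ s / (s + δ) := by positivity
      have e4 : s / (s + δ) ≤ 1 := by rw [div_le_one (by positivity)]; linarith
      have e5 : 0 ≤ m * (σ / (s + σ)) := by positivity
      have e6 : m * (σ / (s + σ)) ≤ m := mul_le_of_le_one_right hm0.le e2
      have e7 : 0 ≤ α * s := by positivity
      have e8 : |l| + m + 1 + α * s ≤ A * (s + δ) := by
        have : A * (s + δ) = (s + δ + 2 / δ * s + 2 + (|l| + m + 1) / δ * s + α * δ) + (|l| + m + 1 + α * s) := by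
          rw [hA]; field_simp; ring
        rw [this]
        have : 0 ≤ (s + δ + 2 / δ * s + 2 + (|l| + m + 1) / δ * s + α * δ) := by positivity
        linarith
      refine le_trans ?_ e8
      rw [abs_le]
      constructor <;> linarith [le_abs_self l, neg_abs_le l]
    have hx0 := hG0 x
    have hx1 := hGle x
    rw [hs] at hx0 hx1
    calc _ ≤ auxG l α m σ δ s * (A * (s + δ)) := mul_le_mul_of_nonneg_left h1 hx0
      _ = A * (auxG l α m σ δ s * (s + δ)) := by ring
      _ ≤ _ := mul_le_mul_of_nonneg_left hx1 hA0
  obtain ⟨I0, E0⟩ := aux_div K θ hθ hI1 hI2 hK0 (auxG l α m σ δ) (auxG' l α m σ δ)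
    (by unfold auxG; fun_prop) (by unfold auxG'; fun_prop)
    (fun s hs => auxG_deriv l α m σ δ s hs hσ hδ hm) A hb1 hb2
  -- pointwise inequality
  have hpt : ∀ x, θ x ^ 2 * K x * ((‖x‖ ^ 2 / (‖x‖ ^ 2 + σ)) ^ m *
      ((c + 2 * α * ‖x‖ ^ 2) / (‖x‖ ^ 2 + δ))) ≤
      2 * ((θ x) ^ 2 * (N * auxG l α m σ δ (‖x‖ ^ 2) + 2 * (‖x‖ ^ 2 * auxG' l α m σ δ (‖x‖ ^ 2))) +
      2 * θ x * fderiv ℝ θ x x * auxG l α m σ δ (‖x‖ ^ 2)) + 4 * M * (‖gradient θ x‖ ^ 2 * K x) := by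
    intro x
    have e0 : θ x ^ 2 * K x * ((‖x‖ ^ 2 / (‖x‖ ^ 2 + σ)) ^ m *
      ((c + 2 * α * ‖x‖ ^ 2) / (‖x‖ ^ 2 + δ))) =
      θ x ^ 2 * (auxG l α m σ δ (‖x‖ ^ 2) * (c + 2 * α * ‖x‖ ^ 2)) := by rw [hG]; ring
    rw [e0, auxG_mul l α m σ δ _ (by positivity) hσ hδ hm]
    have hD := aux_fderiv_le θ x x
    have hg0 := hG0 x
    have hg1 := hGle x
    have hMx := hM (‖x‖ ^ 2) (by positivity)
    have hKx := hK0 x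
    set G := auxG l α m σ δ (‖x‖ ^ 2)
    set D := fderiv ℝ θ x x
    set Z := ‖gradient θ x‖
    set n := ‖x‖ with hn
    have hn0 : 0 ≤ n := norm_nonneg x
    have hZ0 : 0 ≤ Z := norm_nonneg _
    set w := c + 2 * α * n ^ 2 with hw
    have hw0 : 0 < w := by positivity
    have f1 : w ≤ N + 2 * (l + m * (σ / (n ^ 2 + σ)) + α * n ^ 2 - n ^ 2 / (n ^ 2 + δ)) := by
      have e1 : 0 ≤ m * (σ / (n ^ 2 + σ)) := by positivity
      have e4 : n ^ 2 / (n ^ 2 + δ) ≤ 1 := by rw [div_le_one (by positivity)]; linarith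
      rw [hw, hcdef]; linarith
    have f2 : θ x ^ 2 * (G * w) ≤ θ x ^ 2 * (N * G + 2 * (G * (l + m * (σ / (n ^ 2 + σ)) + α * n ^ 2 - n ^ 2 / (n ^ 2 + δ)))) := by
      refine mul_le_mul_of_nonneg_left ?_ (sq_nonneg _)
      nlinarith [mul_le_mul_of_nonneg_left f1 hg0]
    -- cross term
    have f3 : -(4 * θ x * D) ≤ θ x ^ 2 * w + 4 * (Z ^ 2 * n ^ 2) / w := by
      have h1 : D ^ 2 ≤ Z ^ 2 * n ^ 2 := by
        rw [← sq_abs, ← mul_pow]; exact pow_le_pow_left₀ (abs_nonneg _) hD 2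
      have h2 : 4 * D ^ 2 / w ≤ 4 * (Z ^ 2 * n ^ 2) / w := by gcongr
      have h3 : θ x ^ 2 * w + 4 * D ^ 2 / w + 4 * θ x * D = (θ x * w + 2 * D) ^ 2 / w := by
        field_simp; ring
      have h4 : 0 ≤ (θ x * w + 2 * D) ^ 2 / w := by positivity
      linarith
    have f4 : G * (4 * (Z ^ 2 * n ^ 2) / w) ≤ 4 * M * (Z ^ 2 * K x) := by
      have h1 : n ^ 2 / w ≤ M * (n ^ 2 + δ) := by
        rw [div_le_iff₀ hw0]; linarith
      calc G * (4 * (Z ^ 2 * n ^ 2) / w) = 4 * Z ^ 2 * G * (n ^ 2 / w) := by ring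
        _ ≤ 4 * Z ^ 2 * G * (M * (n ^ 2 + δ)) := mul_le_mul_of_nonneg_left h1 (by positivity)
        _ = 4 * M * Z ^ 2 * (G * (n ^ 2 + δ)) := by ring
        _ ≤ 4 * M * Z ^ 2 * K x := mul_le_mul_of_nonneg_left hg1 (by positivity)
        _ = _ := by ring
    have f5 := mul_le_mul_of_nonneg_left f3 hg0
    nlinarith
  have hint : Integrable (fun x => 2 * ((θ x) ^ 2 * (N * auxG l α m σ δ (‖x‖ ^ 2) + 2 * (‖x‖ ^ 2 * auxG' l α m σ δ (‖x‖ ^ 2))) +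
      2 * θ x * fderiv ℝ θ x x * auxG l α m σ δ (‖x‖ ^ 2)) + 4 * M * (‖gradient θ x‖ ^ 2 * K x)) :=
    (I0.const_mul 2).add (hI1.const_mul (4 * M))
  refine (integral_mono_of_nonneg (Filter.Eventually.of_forall fun x => ?_) hint
    (Filter.Eventually.of_forall hpt)).trans ?_
  · have := hK0 x
    simp only [Pi.zero_apply]; positivity
  · rw [integral_add (I0.const_mul 2) (hI1.const_mul (4 * M)), integral_const_mul, integral_const_mul, E0]
    simp

lemma aux_hardy2 (N : ℕ) (hN : 3 ≤ N) (l α δ M : ℝ) (hα : 0 < α) (hδ : 0 < δ)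
    (hc : 0 < (N : ℝ) - 2 + 2 * l)
    (hM : ∀ s : ℝ, 0 ≤ s → s ≤ M * ((s + δ) * ((N : ℝ) - 2 + 2 * l + 2 * α * s)))
    (K : EuclideanSpace ℝ (Fin N) → ℝ)
    (hK : ∀ x, K x = ‖x‖ ^ (2 * l) * Real.exp (α * ‖x‖ ^ 2))
    (θ : EuclideanSpace ℝ (Fin N) → ℝ) (hθ : Differentiable ℝ θ)
    (hI1 : Integrable (fun x => ‖gradient θ x‖ ^ 2 * K x))
    (hI2 : Integrable (fun x => (θ x) ^ 2 * K x)) :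
    Integrable (fun x => θ x ^ 2 * K x *
      (((N : ℝ) - 2 + 2 * l + 2 * α * ‖x‖ ^ 2) / (‖x‖ ^ 2 + δ))) ∧
    ∫ x, θ x ^ 2 * K x *
      (((N : ℝ) - 2 + 2 * l + 2 * α * ‖x‖ ^ 2) / (‖x‖ ^ 2 + δ)) ≤
      4 * M * ∫ x, ‖gradient θ x‖ ^ 2 * K x := by
  set c := (N : ℝ) - 2 + 2 * l with hcdef
  have hK0 : ∀ x, 0 ≤ K x := fun x => by rw [hK]; positivity
  have hKm : Measurable K := by
    rw [funext hK]; fun_prop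
  have hθm : Measurable θ := hθ.continuous.measurable
  have I : Integrable (fun x => θ x ^ 2 * K x *
      ((c + 2 * α * ‖x‖ ^ 2) / (‖x‖ ^ 2 + δ))) := by
    refine Integrable.mono' (hI2.mul_const (c / δ + 2 * α)) (by fun_prop)
      (Filter.Eventually.of_forall fun x => ?_)
    have := hK0 x
    rw [Real.norm_of_nonneg (by positivity)]
    refine mul_le_mul_of_nonneg_left ?_ (by positivity)
    rw [div_le_iff₀ (by positivity)]
    have e : (c / δ + 2 * α) * (‖x‖ ^ 2 + δ) = c / δ * ‖x‖ ^ 2 + 2 * α * δ + (c + 2 * α * ‖x‖ ^ 2) := by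
      field_simp; ring
    have : 0 ≤ c / δ * ‖x‖ ^ 2 + 2 * α * δ := by positivity
    linarith
  refine ⟨I, ?_⟩
  have hm0 : 0 < |l| + 1 := by positivity
  have hm : 1 ≤ l + (|l| + 1) := by linarith [neg_abs_le l]
  set m := |l| + 1
  have hlim : Filter.Tendsto (fun n : ℕ => ∫ x, θ x ^ 2 * K x *
      ((‖x‖ ^ 2 / (‖x‖ ^ 2 + 1 / ((n : ℝ) + 1))) ^ m *
      ((c + 2 * α * ‖x‖ ^ 2) / (‖x‖ ^ 2 + δ)))) Filter.atTop
      (nhds (∫ x, θ x ^ 2 * K x * ((c + 2 * α * ‖x‖ ^ 2) / (‖x‖ ^ 2 + δ)))) := by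
    refine tendsto_integral_of_dominated_convergence _ (fun n => by fun_prop) I
      (fun n => Filter.Eventually.of_forall fun x => ?_) ?_
    · have := hK0 x
      rw [Real.norm_of_nonneg (by positivity)]
      refine mul_le_mul_of_nonneg_left ?_ (by positivity)
      refine mul_le_of_le_one_left (by positivity) ?_
      refine Real.rpow_le_one (by positivity) ?_ hm0.le
      rw [div_le_one (by positivity)]
      have : 0 < 1 / ((n : ℝ) + 1) := by positivity
      linarith
    · have : Nonempty (Fin N) := ⟨⟨0, by omega⟩⟩
      have h0 : ∀ᵐ x : EuclideanSpace ℝ (Fin N), x ≠ 0 := by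
        simp [ae_iff]
      filter_upwards [h0] with x hx
      have hx2 : ‖x‖ ^ 2 ≠ 0 := by simpa using hx
      have t1 : Filter.Tendsto (fun n : ℕ => ‖x‖ ^ 2 / (‖x‖ ^ 2 + 1 / ((n : ℝ) + 1))) Filter.atTop (nhds 1) := by
        have := (tendsto_const_nhds (x := ‖x‖ ^ 2)).div
          ((tendsto_const_nhds (x := ‖x‖ ^ 2)).add tendsto_one_div_add_atTop_nhds_zero_nat)
          (by simpa using hx)
        simpa [div_self hx2, Pi.div_def] using this
      have t2 := t1.rpow_const (p := m) (Or.inl one_ne_zero)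
      rw [Real.one_rpow] at t2
      have := (t2.mul_const ((c + 2 * α * ‖x‖ ^ 2) / (‖x‖ ^ 2 + δ))).const_mul (θ x ^ 2 * K x)
      simpa using this
  refine le_of_tendsto' hlim fun n => ?_
  exact aux_hardy1 N l α (1 / ((n : ℝ) + 1)) δ M hα (by positivity) hδ hc hM m hm0 hm K hK θ hθ hI1 hI2

lemma aux_young (p η : ℝ) (hp : 1 < p) (hη : 0 < η) :
    ∃ C : ℝ, 0 ≤ C ∧ ∀ t : ℝ, t ^ 2 ≤ η * |t| ^ (p + 1) + C := by
  refine ⟨((1 / η) ^ (1 / (p - 1))) ^ 2, by positivity, fun t => ?_⟩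
  have hp' : 0 < p - 1 := by linarith
  rw [← sq_abs]
  generalize ht : |t| = u
  have hu : 0 ≤ u := by rw [← ht]; positivity
  rcases le_total u ((1 / η) ^ (1 / (p - 1))) with h | h
  · have := pow_le_pow_left₀ hu h 2
    have : 0 ≤ η * u ^ (p + 1) := by positivity
    linarith
  · have hu0 : 0 < u := lt_of_lt_of_le (by positivity) h
    have h1 : 1 / η ≤ u ^ (p - 1) := by
      have := Real.rpow_le_rpow (by positivity) h hp'.le
      rwa [← Real.rpow_mul (by positivity), one_div_mul_cancel hp'.ne', Real.rpow_one] at this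
    have h2 : u ^ (p + 1) = u ^ (p - 1) * u ^ 2 := by
      rw [← Real.rpow_two, ← Real.rpow_add hu0]; congr 1; ring
    have h3 : 1 ≤ η * u ^ (p - 1) := by
      rw [div_le_iff₀ hη] at h1; linarith
    rw [h2]
    have : 0 ≤ ((1 / η) ^ (1 / (p - 1))) ^ 2 := by positivity
    nlinarith [mul_le_mul_of_nonneg_right h3 (sq_nonneg u)]

set_option maxHeartbeats 1600000 in
/-- Coercivity estimate: `∫θ²K ≤ ε(∫|∇θ|²K + ∫|θ|^{p+1}|x|^β K) + C_ε`. -/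
theorem stmt8 (N : ℕ) (hN : 3 ≤ N) (l α β p : ℝ)
    (hl : -(((N : ℝ) - 2) / 2) < l) (hα : 0 < α) (hβ : -2 < β) (hp : 1 < p)
    (K : EuclideanSpace ℝ (Fin N) → ℝ)
    (hK : ∀ x, K x = ‖x‖ ^ (2 * l) * Real.exp (α * ‖x‖ ^ 2)) :
    ∀ ε > 0, ∃ C > 0, ∀ θ : EuclideanSpace ℝ (Fin N) → ℝ,
      Differentiable ℝ θ →
      Integrable (fun x => ‖gradient θ x‖ ^ 2 * K x) →
      Integrable (fun x => (θ x) ^ 2 * K x) →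
      Integrable (fun x => |θ x| ^ (p + 1) * ‖x‖ ^ β * K x) →
      ∫ x, (θ x) ^ 2 * K x ≤
        ε * ((∫ x, ‖gradient θ x‖ ^ 2 * K x) + ∫ x, |θ x| ^ (p + 1) * ‖x‖ ^ β * K x) + C := by
  intro ε hε
  have hc : 0 < (N : ℝ) - 2 + 2 * l := by linarith
  have hK0 : ∀ x, 0 ≤ K x := fun x => by rw [hK]; positivity
  obtain ⟨c, hcdef⟩ : ∃ c, c = (N : ℝ) - 2 + 2 * l := ⟨_, rfl⟩
  rw [← hcdef] at hc
  obtain ⟨d, hd⟩ : ∃ d, d = ε * c ^ 2 / 16 := ⟨_, rfl⟩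
  obtain ⟨D, hD⟩ : ∃ D, D = 4 / (α ^ 2 * ε) := ⟨_, rfl⟩
  have hd0 : 0 < d := by rw [hd]; positivity
  have hD0 : 0 < D := by rw [hD]; positivity
  have hpos : ∀ t ∈ Set.Icc (√d) (√D), t ≠ 0 := fun t ht =>
    (lt_of_lt_of_le (Real.sqrt_pos.2 hd0) ht.1).ne'
  obtain ⟨B1, hB1⟩ := (isCompact_Icc (a := √d) (b := √D)).exists_bound_of_continuousOn
    (f := fun t : ℝ => t ^ (2 * l) * Real.exp (α * t ^ 2))
    ((continuousOn_id.rpow_const fun t ht => Or.inl (hpos t ht)).mul (by fun_prop))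
  obtain ⟨B2, hB2⟩ := (isCompact_Icc (a := √d) (b := √D)).exists_bound_of_continuousOn
    (f := fun t : ℝ => t ^ (-β))
    (continuousOn_id.rpow_const fun t ht => Or.inl (hpos t ht))
  obtain ⟨C', hC'0, hC'⟩ := aux_young p (ε / (|B2| + 1)) hp (by positivity)
  set ball := Metric.closedBall (0 : EuclideanSpace ℝ (Fin N)) (√D) with hball
  have hballfin : volume ball ≠ ⊤ := measure_closedBall_lt_top.ne
  refine ⟨C' * |B1| * volume.real ball + 1, by positivity, ?_⟩
  intro θ hθ hI1 hI2 hI3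
  obtain ⟨J1, E1⟩ := aux_hardy2 N hN l α d (1 / c) hα hd0 (by rw [← hcdef]; exact hc)
    (by
      intro s hs
      rw [← hcdef, div_mul_eq_mul_div, one_mul, le_div_iff₀ hc]
      nlinarith [mul_nonneg hs hα.le, mul_nonneg hd0.le hc.le, mul_nonneg (mul_nonneg hs hα.le) hs, mul_nonneg (mul_nonneg hs hα.le) hd0.le]) K hK θ hθ hI1 hI2
  obtain ⟨J2, E2⟩ := aux_hardy2 N hN l α D (1 / (2 * α * D)) hα hD0 (by rw [← hcdef]; exact hc)
    (by
      intro s hs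
      rw [← hcdef, div_mul_eq_mul_div, one_mul, le_div_iff₀ (by positivity)]
      nlinarith [mul_nonneg hs hc.le, mul_nonneg hD0.le hc.le, mul_nonneg (mul_nonneg hs hα.le) hs]) K hK θ hθ hI1 hI2
  rw [← hcdef] at J1 E1 J2 E2
  have J4 : Integrable (ball.indicator fun _ => C' * |B1|) :=
    (integrable_indicator_iff Metric.isClosed_closedBall.measurableSet).2
      (integrableOn_const hballfin)
  have E4 : ∫ x, ball.indicator (fun _ => C' * |B1|) x = C' * |B1| * volume.real ball := by
    rw [integral_indicator Metric.isClosed_closedBall.measurableSet, setIntegral_const, smul_eq_mul,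
      mul_comm]
  have hpt : ∀ x, θ x ^ 2 * K x ≤
      2 * d / c * (θ x ^ 2 * K x * ((c + 2 * α * ‖x‖ ^ 2) / (‖x‖ ^ 2 + d))) +
      1 / α * (θ x ^ 2 * K x * ((c + 2 * α * ‖x‖ ^ 2) / (‖x‖ ^ 2 + D))) +
      (ε * (|θ x| ^ (p + 1) * ‖x‖ ^ β * K x) + ball.indicator (fun _ => C' * |B1|) x) := by
    intro x
    have hKx := hK0 x
    have p1 : 0 ≤ 2 * d / c * (θ x ^ 2 * K x * ((c + 2 * α * ‖x‖ ^ 2) / (‖x‖ ^ 2 + d))) := by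
      positivity
    have p2 : 0 ≤ 1 / α * (θ x ^ 2 * K x * ((c + 2 * α * ‖x‖ ^ 2) / (‖x‖ ^ 2 + D))) := by
      positivity
    have p3 : 0 ≤ ε * (|θ x| ^ (p + 1) * ‖x‖ ^ β * K x) := by positivity
    have p4 : 0 ≤ ball.indicator (fun _ => C' * |B1|) x :=
      Set.indicator_nonneg (fun _ _ => by positivity) x
    have hT : 0 ≤ θ x ^ 2 * K x := by positivity
    rcases lt_or_ge (‖x‖ ^ 2) d with h | h
    · have h1 : 1 ≤ 2 * d / c * ((c + 2 * α * ‖x‖ ^ 2) / (‖x‖ ^ 2 + d)) := by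
        rw [div_mul_div_comm, le_div_iff₀ (by positivity)]
        have : 0 ≤ d * (α * ‖x‖ ^ 2) := by positivity
        nlinarith
      have := mul_le_mul_of_nonneg_left h1 hT
      nlinarith
    rcases lt_or_ge D (‖x‖ ^ 2) with h' | h'
    · have h1 : 1 ≤ 1 / α * ((c + 2 * α * ‖x‖ ^ 2) / (‖x‖ ^ 2 + D)) := by
        rw [div_mul_div_comm, le_div_iff₀ (by positivity)]
        nlinarith
      have := mul_le_mul_of_nonneg_left h1 hT
      nlinarith
    · have hn : ‖x‖ ∈ Set.Icc (√d) (√D) :=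
        ⟨Real.sqrt_le_iff.2 ⟨norm_nonneg _, h⟩, Real.le_sqrt_of_sq_le h'⟩
      have hn0 : 0 < ‖x‖ := lt_of_le_of_ne (norm_nonneg _) (hpos _ hn).symm
      have b1 : K x ≤ |B1| := by
        rw [hK]
        exact (le_abs_self _).trans ((hB1 _ hn).trans (le_abs_self _))
      have b2 : ‖x‖ ^ (-β) ≤ |B2| + 1 := by
        have := (le_abs_self _).trans ((hB2 _ hn).trans (le_abs_self _))
        linarith
      have b3 : ε / (|B2| + 1) ≤ ε * ‖x‖ ^ β := by
        rw [Real.rpow_neg hn0.le] at b2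
        rw [div_le_iff₀ (by positivity)]
        have h0 : 0 < ‖x‖ ^ β := by positivity
        have : 1 ≤ ‖x‖ ^ β * (|B2| + 1) := by
          have := mul_le_mul_of_nonneg_left b2 h0.le
          rwa [mul_inv_cancel₀ h0.ne'] at this
        nlinarith
      have hx : x ∈ ball := by simpa [hball] using hn.2
      rw [Set.indicator_of_mem hx]
      have y1 : θ x ^ 2 ≤ ε * ‖x‖ ^ β * |θ x| ^ (p + 1) + C' :=
        (hC' (θ x)).trans (by gcongr)
      have y2 := mul_le_mul_of_nonneg_right y1 hKx
      have y3 := mul_le_mul_of_nonneg_left b1 hC'0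
      have y4 : (ε * ‖x‖ ^ β * |θ x| ^ (p + 1) + C') * K x =
        ε * (|θ x| ^ (p + 1) * ‖x‖ ^ β * K x) + C' * K x := by ring
      rw [y4] at y2
      linarith
  have hint := integral_mono hI2 (((J1.const_mul (2 * d / c)).add (J2.const_mul (1 / α))).add
    ((hI3.const_mul ε).add J4)) hpt
  refine hint.trans ?_
  have e5 : ∀ (f1 f2 f3 f4 : EuclideanSpace ℝ (Fin N) → ℝ), Integrable f1 → Integrable f2 →
      Integrable f3 → Integrable f4 → ∫ x, (f1 + f2 + (f3 + f4)) x =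
      (∫ x, f1 x) + (∫ x, f2 x) + ((∫ x, f3 x) + ∫ x, f4 x) := by
    intro f1 f2 f3 f4 h1 h2 h3 h4
    rw [integral_add' (h1.add h2) (h3.add h4), integral_add' h1 h2, integral_add' h3 h4]
  have e6 := e5 _ _ _ _ (J1.const_mul (2 * d / c)) (J2.const_mul (1 / α)) (hI3.const_mul ε) J4
  refine e6.le.trans ?_
  rw [integral_const_mul, integral_const_mul, integral_const_mul, E4]
  have k1 := mul_le_mul_of_nonneg_left E1 (by positivity : 0 ≤ 2 * d / c)
  have k2 := mul_le_mul_of_nonneg_left E2 (by positivity : 0 ≤ 1 / α)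
  have k3 : 2 * d / c * (4 * (1 / c) * ∫ x, ‖gradient θ x‖ ^ 2 * K x) =
      ε / 2 * ∫ x, ‖gradient θ x‖ ^ 2 * K x := by
    rw [hd]; field_simp; ring
  have k4 : 1 / α * (4 * (1 / (2 * α * D)) * ∫ x, ‖gradient θ x‖ ^ 2 * K x) =
      ε / 2 * ∫ x, ‖gradient θ x‖ ^ 2 * K x := by
    rw [hD]; field_simp
  rw [k3] at k1
  rw [k4] at k2
  linarith
end
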